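/- With g(c,s) = ∑_{k=1}^n k a_k s_k, h(c,s) = ∑_{k=1}^n a_k c_k, and ‖f‖₁² := (1/2) ∫ (∑_{j=1}^n j(s_j ∂_{c_j} f − c_j ∂_{s_j} f))² dπ, one has for every smooth compactly supported f: |∫ g f dπ| ≤ ‖h‖_{L²(π)} · √2 · ‖f‖₁. Consequently the H_{-1}-norm of g satisfies ‖g‖_{-1} ≤ ‖h‖_{L²(π)} = √(∑_{j=1}^n a_j/j²). -/

import Mathlib

open MeasureTheory

/-- The Gaussian potential `Φ(c,s) = (1/2) ∑ a_k k² (c_k² + s_k²)` (paper index `k+1`). -/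
noncomputable def Phi (n : ℕ) (a : Fin n → ℝ) (p : (Fin n → ℝ) × (Fin n → ℝ)) : ℝ :=
  (1 / 2) * ∑ k, a k * ((k : ℝ) + 1) ^ 2 * ((p.1 k) ^ 2 + (p.2 k) ^ 2)

/-- The Gaussian measure `π(dc ds) = C⁻¹ e^{-Φ(c,s)} dc ds` on `ℝ^{2n}`. -/
noncomputable def gaussPi (n : ℕ) (a : Fin n → ℝ) (C : ℝ) :
    Measure ((Fin n → ℝ) × (Fin n → ℝ)) :=
  (ENNReal.ofReal C)⁻¹ •
    (volume.withDensity fun p => ENNReal.ofReal (Real.exp (-Phi n a p)))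

/-- The first-order differential operator `Df = ∑_j j (s_j ∂_{c_j} f − c_j ∂_{s_j} f)`. -/
noncomputable def Dop (n : ℕ) (f : (Fin n → ℝ) × (Fin n → ℝ) → ℝ)
    (p : (Fin n → ℝ) × (Fin n → ℝ)) : ℝ :=
  ∑ j : Fin n, ((j : ℝ) + 1) *
    (p.2 j * fderiv ℝ f p ((Pi.single j 1 : Fin n → ℝ), (0 : Fin n → ℝ))
      - p.1 j * fderiv ℝ f p ((0 : Fin n → ℝ), (Pi.single j 1 : Fin n → ℝ)))


abbrev XX (n : ℕ) := (Fin n → ℝ) × (Fin n → ℝ)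

lemma Phi_continuous (n : ℕ) (a : Fin n → ℝ) : Continuous (Phi n a) := by
  unfold Phi; fun_prop

lemma w_integrable (n : ℕ) (a : Fin n → ℝ) (ha : ∀ k, 0 < a k) :
    Integrable (fun p : XX n => Real.exp (-Phi n a p)) := by
  have h1 : Integrable (fun v : Fin n → ℝ =>
      ∏ k, Real.exp (-(a k * ((k : ℝ) + 1) ^ 2 / 2) * (v k) ^ 2)) := by
    apply Integrable.fintype_prod
      (f := fun (k : Fin n) (x : ℝ) => Real.exp (-(a k * ((k : ℝ) + 1) ^ 2 / 2) * x ^ 2))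
    intro k
    apply integrable_exp_neg_mul_sq
    have := ha k
    positivity
  have h2 := Integrable.mul_prod h1 h1
  rw [← Measure.volume_eq_prod] at h2
  refine h2.congr (Filter.Eventually.of_forall fun p => ?_)
  simp only [← Real.exp_sum, ← Real.exp_add]
  congr 1
  unfold Phi
  rw [← Finset.sum_add_distrib, Finset.mul_sum, ← Finset.sum_neg_distrib]
  refine Finset.sum_congr rfl fun k _ => ?_
  ring

lemma w_le (n : ℕ) (a : Fin n → ℝ) (ha : ∀ k, 0 < a k) (i : Fin n) (p : XX n) :
    (p.1 i) ^ 2 * Real.exp (-Phi n a p)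
      ≤ (4 / (a i * ((i : ℝ) + 1) ^ 2)) * Real.exp (-Phi n (fun k => a k / 2) p) := by
  set b := a i * ((i : ℝ) + 1) ^ 2 with hb
  have hbp : 0 < b := by have := ha i; positivity
  have e1 : Phi n a p = Phi n (fun k => a k / 2) p + Phi n (fun k => a k / 2) p := by
    unfold Phi
    rw [← mul_add, ← Finset.sum_add_distrib]
    congr 1
    refine Finset.sum_congr rfl fun k _ => ?_
    ring
  have e2 : b / 4 * (p.1 i) ^ 2 ≤ Phi n (fun k => a k / 2) p := by
    unfold Phi
    have := Finset.single_le_sum (s := Finset.univ)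
      (f := fun k : Fin n => a k / 2 * ((k : ℝ) + 1) ^ 2 * ((p.1 k) ^ 2 + (p.2 k) ^ 2))
      (fun k _ => by have := ha k; positivity) (Finset.mem_univ i)
    have h3 : 0 ≤ b * (p.2 i) ^ 2 := by positivity
    rw [hb] at *
    nlinarith
  rw [e1, neg_add, Real.exp_add, ← mul_assoc]
  refine mul_le_mul_of_nonneg_right ?_ (Real.exp_pos _).le
  set q := Phi n (fun k => a k / 2) p
  have e3 : q * Real.exp (-q) ≤ 1 := by
    have h := Real.add_one_le_exp q
    rw [Real.exp_neg, ← div_eq_mul_inv, div_le_one (Real.exp_pos _)]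
    linarith
  have e4 : (p.1 i) ^ 2 ≤ 4 / b * q := by
    rw [div_mul_eq_mul_div, le_div_iff₀ hbp]
    nlinarith
  calc _ ≤ 4 / b * q * Real.exp (-q) :=
        mul_le_mul_of_nonneg_right e4 (Real.exp_pos _).le
    _ = 4 / b * (q * Real.exp (-q)) := by ring
    _ ≤ 4 / b * 1 := mul_le_mul_of_nonneg_left e3 (by positivity)
    _ = _ := mul_one _

lemma sq_integrable (n : ℕ) (a : Fin n → ℝ) (ha : ∀ k, 0 < a k) (i : Fin n) :
    Integrable (fun p : XX n => (p.1 i) ^ 2 * Real.exp (-Phi n a p)) := by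
  have hP := Phi_continuous n a
  refine Integrable.mono' ((w_integrable n (fun k => a k / 2)
    (fun k => by have := ha k; positivity)).const_mul (4 / (a i * ((i : ℝ) + 1) ^ 2)))
    (by apply Continuous.aestronglyMeasurable; fun_prop)
    (Filter.Eventually.of_forall fun p => ?_)
  rw [Real.norm_of_nonneg (by positivity)]
  exact w_le n a ha i p

lemma mul_integrable (n : ℕ) (a : Fin n → ℝ) (ha : ∀ k, 0 < a k) (i j : Fin n) :
    Integrable (fun p : XX n => p.1 i * p.1 j * Real.exp (-Phi n a p)) := by
  have hP := Phi_continuous n a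
  refine Integrable.mono' ((sq_integrable n a ha i).add (sq_integrable n a ha j))
    (by apply Continuous.aestronglyMeasurable; fun_prop)
    (Filter.Eventually.of_forall fun p => ?_)
  simp only [Pi.add_apply]
  rw [norm_mul, Real.norm_of_nonneg (Real.exp_pos _).le, ← add_mul]
  refine mul_le_mul_of_nonneg_right ?_ (Real.exp_pos _).le
  rw [Real.norm_eq_abs, abs_le]
  constructor <;> nlinarith [sq_nonneg (p.1 i + p.1 j), sq_nonneg (p.1 i - p.1 j)]

lemma lin_integrable (n : ℕ) (a : Fin n → ℝ) (ha : ∀ k, 0 < a k) (i : Fin n) :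
    Integrable (fun p : XX n => p.1 i * Real.exp (-Phi n a p)) := by
  have hP := Phi_continuous n a
  refine Integrable.mono' ((sq_integrable n a ha i).add (w_integrable n a ha))
    (by apply Continuous.aestronglyMeasurable; fun_prop)
    (Filter.Eventually.of_forall fun p => ?_)
  simp only [Pi.add_apply]
  rw [norm_mul, Real.norm_of_nonneg (Real.exp_pos _).le, ← add_one_mul]
  refine mul_le_mul_of_nonneg_right ?_ (Real.exp_pos _).le
  rw [Real.norm_eq_abs, abs_le]
  constructor <;> nlinarith [sq_nonneg (p.1 i + 1), sq_nonneg (p.1 i - 1)]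

/-- Integration by parts in direction `e`. -/
lemma ibp (n : ℕ) {u u' v v' : XX n → ℝ} {e : XX n}
    (h1 : Integrable (fun p => u' p * v p)) (h2 : Integrable (fun p => u p * v' p))
    (h3 : Integrable (fun p => u p * v p))
    (hu : ∀ p, HasLineDerivAt ℝ u (u' p) p e) (hv : ∀ p, HasLineDerivAt ℝ v (v' p) p e) :
    ∫ p, u p * v' p = - ∫ p, u' p * v p := by
  have : (volume : Measure (XX n)).IsAddHaarMeasure := by
    rw [Measure.volume_eq_prod]; exact Measure.prod.instIsAddHaarMeasure _ _
  exact integral_bilinear_hasLineDerivAt_right_eq_neg_left_of_integrable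
    (B := ContinuousLinearMap.mul ℝ ℝ) (μ := volume) h1 h2 h3
    (fun x _ => hu x) (fun x _ => hv x)

lemma fst_deriv (n : ℕ) (i : Fin n) (p e : XX n) :
    HasLineDerivAt ℝ (fun p : XX n => p.1 i) (e.1 i) p e := by
  unfold HasLineDerivAt
  simpa using ((hasDerivAt_id (0 : ℝ)).mul_const (e.1 i)).const_add (p.1 i)

lemma snd_deriv (n : ℕ) (i : Fin n) (p e : XX n) :
    HasLineDerivAt ℝ (fun p : XX n => p.2 i) (e.2 i) p e := by
  unfold HasLineDerivAt
  simpa using ((hasDerivAt_id (0 : ℝ)).mul_const (e.2 i)).const_add (p.2 i)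

lemma w_deriv (n : ℕ) (a : Fin n → ℝ) (p e : XX n) :
    HasLineDerivAt ℝ (fun p : XX n => Real.exp (-Phi n a p))
      (-(∑ k, a k * ((k : ℝ) + 1) ^ 2 * (p.1 k * e.1 k + p.2 k * e.2 k)) *
        Real.exp (-Phi n a p)) p e := by
  have h : HasLineDerivAt ℝ (Phi n a)
      (∑ k, a k * ((k : ℝ) + 1) ^ 2 * (p.1 k * e.1 k + p.2 k * e.2 k)) p e := by
    unfold HasLineDerivAt
    unfold Phi
    have := (HasDerivAt.fun_sum (u := Finset.univ) (x := (0 : ℝ)) (fun k _ =>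
      (((fst_deriv n k p e).fun_pow 2).fun_add ((snd_deriv n k p e).fun_pow 2)).const_mul
        (a k * ((k : ℝ) + 1) ^ 2))).const_mul (1 / 2 : ℝ)
    refine this.congr_deriv ?_
    rw [Finset.mul_sum]
    refine Finset.sum_congr rfl fun k _ => ?_
    simp
    ring
  have h2 := HasDerivAt.exp (HasDerivAt.fun_neg h)
  unfold HasLineDerivAt
  refine h2.congr_deriv ?_
  simp
  ring

lemma cov (n : ℕ) (a : Fin n → ℝ) (ha : ∀ k, 0 < a k) (i j : Fin n) :
    ∫ p : XX n, p.1 i * p.1 j * Real.exp (-Phi n a p)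
      = (if i = j then 1 / (a j * ((j : ℝ) + 1) ^ 2) else 0) *
        ∫ p : XX n, Real.exp (-Phi n a p) := by
  have hb : 0 < a j * ((j : ℝ) + 1) ^ 2 := by have := ha j; positivity
  have key := ibp n (u := fun p : XX n => p.1 i) (u' := fun _ => if i = j then 1 else 0)
    (v := fun p : XX n => Real.exp (-Phi n a p))
    (v' := fun p => -(a j * ((j : ℝ) + 1) ^ 2) * (p.1 j * Real.exp (-Phi n a p)))
    (e := (Pi.single j 1, 0))
    ((w_integrable n a ha).const_mul _)
    (by
      refine ((mul_integrable n a ha i j).const_mul (-(a j * ((j : ℝ) + 1) ^ 2))).congr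
        (Filter.Eventually.of_forall fun p => ?_)
      simp only
      ring)
    (lin_integrable n a ha i)
    (fun p => by
      have := fst_deriv n i p (Pi.single j 1, 0)
      simpa [Pi.single_apply] using this)
    (fun p => by
      have := w_deriv n a p (Pi.single j 1, 0)
      simpa [Pi.single_apply, mul_assoc] using this)
  rw [integral_const_mul] at key
  have e : ∫ p : XX n, p.1 i * (-(a j * ((j : ℝ) + 1) ^ 2) * (p.1 j * Real.exp (-Phi n a p)))
      = -(a j * ((j : ℝ) + 1) ^ 2) * ∫ p : XX n, p.1 i * p.1 j * Real.exp (-Phi n a p) := by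
    rw [← integral_const_mul]
    congr 1
    ext p
    ring
  rw [e] at key
  split_ifs at key ⊢
  · rw [div_mul_eq_mul_div, eq_div_iff hb.ne']
    linarith
  · have : (a j * ((j : ℝ) + 1) ^ 2) * ∫ p : XX n, p.1 i * p.1 j * Real.exp (-Phi n a p) = 0 := by
      linarith
    rw [zero_mul]
    exact (mul_eq_zero.mp this).resolve_left hb.ne'

lemma hsq_expand (n : ℕ) (a : Fin n → ℝ) (p : XX n) :
    (∑ k : Fin n, a k * p.1 k) ^ 2 * Real.exp (-Phi n a p)
      = ∑ i, ∑ j, a i * a j * (p.1 i * p.1 j * Real.exp (-Phi n a p)) := by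
  rw [sq, Finset.sum_mul_sum, Finset.sum_mul]
  refine Finset.sum_congr rfl fun i _ => ?_
  rw [Finset.sum_mul]
  refine Finset.sum_congr rfl fun j _ => ?_
  ring

lemma hsq_integrable (n : ℕ) (a : Fin n → ℝ) (ha : ∀ k, 0 < a k) :
    Integrable (fun p : XX n => (∑ k : Fin n, a k * p.1 k) ^ 2 * Real.exp (-Phi n a p)) := by
  simp only [hsq_expand]
  exact integrable_finsetSum _ fun i _ => integrable_finsetSum _ fun j _ =>
    (mul_integrable n a ha i j).const_mul _

lemma hsq_integral (n : ℕ) (a : Fin n → ℝ) (ha : ∀ k, 0 < a k) :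
    ∫ p : XX n, (∑ k : Fin n, a k * p.1 k) ^ 2 * Real.exp (-Phi n a p)
      = (∑ j : Fin n, a j / ((j : ℝ) + 1) ^ 2) * ∫ p : XX n, Real.exp (-Phi n a p) := by
  simp only [hsq_expand]
  rw [integral_finsetSum _ fun i _ => integrable_finsetSum _ fun j _ =>
    (mul_integrable n a ha i j).const_mul _, Finset.sum_mul]
  refine Finset.sum_congr rfl fun i _ => ?_
  rw [integral_finsetSum _ fun j _ => (mul_integrable n a ha i j).const_mul _]
  simp only [integral_const_mul, cov n a ha]
  rw [Finset.sum_eq_single i]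
  · have := ha i
    simp
    field_simp
  · intro j _ hj
    simp [hj.symm]
  · simp

lemma gauss_integral (n : ℕ) (a : Fin n → ℝ) (C : ℝ) (F : XX n → ℝ) :
    ∫ p, F p ∂(gaussPi n a C)
      = ((ENNReal.ofReal C)⁻¹).toReal * ∫ p, F p * Real.exp (-Phi n a p) := by
  have hP := Phi_continuous n a
  unfold gaussPi
  rw [integral_smul_measure, integral_withDensity_eq_integral_toReal_smul
    (by apply Measurable.ennreal_ofReal; apply Continuous.measurable; fun_prop) (by simp)]
  simp only [smul_eq_mul, ENNReal.toReal_ofReal (Real.exp_pos _).le, mul_comm]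

lemma gauss_one (n : ℕ) (a : Fin n → ℝ) (C : ℝ) (hprob : IsProbabilityMeasure (gaussPi n a C)) :
    ((ENNReal.ofReal C)⁻¹).toReal * ∫ p : XX n, Real.exp (-Phi n a p) = 1 := by
  have := gauss_integral n a C (fun _ => 1)
  simpa using this.symm

lemma gauss_h_integrable (n : ℕ) (a : Fin n → ℝ) (ha : ∀ k, 0 < a k) (C : ℝ)
    (hprob : IsProbabilityMeasure (gaussPi n a C)) :
    Integrable (fun p : XX n => (∑ k : Fin n, a k * p.1 k) ^ 2) (gaussPi n a C) := by
  have hP := Phi_continuous n a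
  have h1 := gauss_one n a C hprob
  have hC : (ENNReal.ofReal C)⁻¹ ≠ ⊤ := by
    intro h
    rw [h] at h1
    simp at h1
  unfold gaussPi
  refine Integrable.smul_measure ?_ hC
  rw [integrable_withDensity_iff (by apply Measurable.ennreal_ofReal; apply Continuous.measurable; fun_prop) (by simp)]
  simp only [ENNReal.toReal_ofReal (Real.exp_pos _).le]
  exact hsq_integrable n a ha

lemma cs {α : Type*} [MeasurableSpace α] (μ : Measure α) (f g : α → ℝ)
    (hf : MemLp f 2 μ) (hg : MemLp g 2 μ) :
    |∫ x, f x * g x ∂μ| ≤ Real.sqrt (∫ x, f x ^ 2 ∂μ) * Real.sqrt (∫ x, g x ^ 2 ∂μ) := by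
  have h := integral_mul_norm_le_Lp_mul_Lq (μ := μ) (f := f) (g := g) (p := 2) (q := 2)
    Real.HolderConjugate.two_two (by simpa using hf) (by simpa using hg)
  simp only [Real.norm_eq_abs, Real.rpow_two, sq_abs] at h
  rw [Real.sqrt_eq_rpow, Real.sqrt_eq_rpow]
  refine le_trans ?_ h
  simpa [abs_mul] using norm_integral_le_integral_norm (μ := μ) (fun x => f x * g x)

set_option linter.unusedVariables false

lemma f_int (n : ℕ) (f : XX n → ℝ) (hf : ContDiff ℝ (⊤ : ℕ∞) f)
    (hc : HasCompactSupport f) (q : XX n → ℝ) (hq : Continuous q) : Integrable (fun p => q p * f p) :=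
  (hq.mul hf.continuous).integrable_of_hasCompactSupport hc.mul_left

lemma df_cont (n : ℕ) (f : XX n → ℝ) (hf : ContDiff ℝ (⊤ : ℕ∞) f)
    (hc : HasCompactSupport f) (e : XX n) : Continuous (fun p => fderiv ℝ f p e) :=
  (hf.continuous_fderiv (by simp)).clm_apply continuous_const

lemma df_supp (n : ℕ) (f : XX n → ℝ) (hf : ContDiff ℝ (⊤ : ℕ∞) f)
    (hc : HasCompactSupport f) (e : XX n) : HasCompactSupport (fun p => fderiv ℝ f p e) :=
  hc.fderiv_apply ℝ e

lemma df_int (n : ℕ) (f : XX n → ℝ) (hf : ContDiff ℝ (⊤ : ℕ∞) f)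
    (hc : HasCompactSupport f) (q : XX n → ℝ) (hq : Continuous q) (e : XX n) :
    Integrable (fun p => q p * fderiv ℝ f p e) :=
  (hq.mul (df_cont n f hf hc e)).integrable_of_hasCompactSupport (df_supp n f hf hc e).mul_left

lemma f_deriv (n : ℕ) (f : XX n → ℝ) (hf : ContDiff ℝ (⊤ : ℕ∞) f)
    (hc : HasCompactSupport f) (p e : XX n) : HasLineDerivAt ℝ f (fderiv ℝ f p e) p e :=
  ((hf.differentiable (by simp)) p).hasFDerivAt.hasLineDerivAt e

lemma f_ibp (n : ℕ) (f : XX n → ℝ) (hf : ContDiff ℝ (⊤ : ℕ∞) f)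
    (hc : HasCompactSupport f) (q q' : XX n → ℝ) (hq : Continuous q) (hq' : Continuous q') (e : XX n)
    (h : ∀ p, HasLineDerivAt ℝ q (q' p) p e) :
    ∫ p, q p * fderiv ℝ f p e = - ∫ p, q' p * f p :=
  ibp n (f_int n f hf hc q' hq') (df_int n f hf hc q hq e) (f_int n f hf hc q hq) h
    (fun p => f_deriv n f hf hc p e)

lemma h_deriv (n : ℕ) (a : Fin n → ℝ) (f : XX n → ℝ) (hf : ContDiff ℝ (⊤ : ℕ∞) f)
    (hc : HasCompactSupport f) (p e : XX n) : HasLineDerivAt ℝ (fun p : XX n => ∑ k : Fin n, a k * p.1 k)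
    (∑ k, a k * e.1 k) p e :=
  HasDerivAt.fun_sum fun k _ => HasDerivAt.const_mul (a k) (fst_deriv n k p e)

lemma part_j (n : ℕ) (a : Fin n → ℝ) (f : XX n → ℝ) (hf : ContDiff ℝ (⊤ : ℕ∞) f)
    (hc : HasCompactSupport f) (j : Fin n) :
    ∫ p : XX n, (∑ k : Fin n, a k * p.1 k) * Real.exp (-Phi n a p) *
      (p.2 j * fderiv ℝ f p ((Pi.single j 1 : Fin n → ℝ), (0 : Fin n → ℝ))
      - p.1 j * fderiv ℝ f p ((0 : Fin n → ℝ), (Pi.single j 1 : Fin n → ℝ)))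
    = - ∫ p : XX n, a j * p.2 j * Real.exp (-Phi n a p) * f p := by
  have hP := Phi_continuous n a
  set e1 : XX n := ((Pi.single j 1 : Fin n → ℝ), (0 : Fin n → ℝ)) with he1
  set e2 : XX n := ((0 : Fin n → ℝ), (Pi.single j 1 : Fin n → ℝ)) with he2
  set b := a j * ((j : ℝ) + 1) ^ 2 with hb
  let H : XX n → ℝ := fun p => ∑ k : Fin n, a k * p.1 k
  let w : XX n → ℝ := fun p => Real.exp (-Phi n a p)
  have hH : Continuous H := by unfold H; fun_prop
  have hw : Continuous w := by unfold w; fun_prop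
  have k1 := f_ibp n f hf hc (fun p => H p * p.2 j * w p)
    (fun p => a j * p.2 j * w p - b * H p * p.1 j * p.2 j * w p)
    (by fun_prop) (by fun_prop) e1 (fun p => by
      have := HasDerivAt.fun_mul (HasDerivAt.fun_mul (h_deriv n a f hf hc p e1)
        (snd_deriv n j p e1)) (w_deriv n a p e1)
      refine HasDerivAt.congr_deriv this ?_
      simp [he1, Pi.single_apply, H, w, hb]
      ring)
  have k2 := f_ibp n f hf hc (fun p => H p * p.1 j * w p)
    (fun p => - (b * H p * p.1 j * p.2 j * w p))
    (by fun_prop) (by fun_prop) e2 (fun p => by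
      have := HasDerivAt.fun_mul (HasDerivAt.fun_mul (h_deriv n a f hf hc p e2)
        (fst_deriv n j p e2)) (w_deriv n a p e2)
      refine HasDerivAt.congr_deriv this ?_
      simp [he2, Pi.single_apply, H, w, hb]
      ring)
  have i1 := df_int n f hf hc (fun p => H p * p.2 j * w p) (by fun_prop) e1
  have i2 := df_int n f hf hc (fun p => H p * p.1 j * w p) (by fun_prop) e2
  have i3 := f_int n f hf hc (fun p => a j * p.2 j * w p - b * H p * p.1 j * p.2 j * w p)
    (by fun_prop)
  have i4 := f_int n f hf hc (fun p => - (b * H p * p.1 j * p.2 j * w p)) (by fun_prop)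
  calc _ = ∫ p : XX n, (H p * p.2 j * w p * fderiv ℝ f p e1
          - H p * p.1 j * w p * fderiv ℝ f p e2) := by
        congr 1; ext p; simp only [H, w]; ring
    _ = _ := by
        rw [integral_sub i1 i2, k1, k2, ← neg_add', neg_inj, ← sub_eq_add_neg,
          ← integral_sub i3 i4]
        congr 1; ext p; simp only [w]; ring

lemma part_all (n : ℕ) (a : Fin n → ℝ) (f : XX n → ℝ) (hf : ContDiff ℝ (⊤ : ℕ∞) f)
    (hc : HasCompactSupport f) :
    ∫ p : XX n, (∑ k : Fin n, ((k : ℝ) + 1) * a k * p.2 k) * f p * Real.exp (-Phi n a p)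
    = - ∫ p : XX n, (∑ k : Fin n, a k * p.1 k) * Dop n f p * Real.exp (-Phi n a p) := by
  have hP := Phi_continuous n a
  have e1 : ∀ p : XX n, (∑ k : Fin n, ((k : ℝ) + 1) * a k * p.2 k) * f p * Real.exp (-Phi n a p)
      = ∑ k : Fin n, ((k : ℝ) + 1) * (a k * p.2 k * Real.exp (-Phi n a p) * f p) := by
    intro p
    rw [Finset.sum_mul, Finset.sum_mul]
    exact Finset.sum_congr rfl fun k _ => by ring
  have e2 : ∀ p : XX n, (∑ k : Fin n, a k * p.1 k) * Dop n f p * Real.exp (-Phi n a p)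
      = ∑ j : Fin n, ((j : ℝ) + 1) * ((∑ k : Fin n, a k * p.1 k) * Real.exp (-Phi n a p) *
      (p.2 j * fderiv ℝ f p ((Pi.single j 1 : Fin n → ℝ), (0 : Fin n → ℝ))
      - p.1 j * fderiv ℝ f p ((0 : Fin n → ℝ), (Pi.single j 1 : Fin n → ℝ)))) := by
    intro p
    unfold Dop
    rw [Finset.mul_sum, Finset.sum_mul]
    exact Finset.sum_congr rfl fun k _ => by ring
  simp only [e1, e2]
  rw [integral_finsetSum _ fun j _ =>
      (f_int n f hf hc (fun p => a j * p.2 j * Real.exp (-Phi n a p)) (by fun_prop)).const_mul _,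
    integral_finsetSum, ← Finset.sum_neg_distrib]
  · refine Finset.sum_congr rfl fun j _ => ?_
    rw [integral_const_mul, integral_const_mul, part_j n a f hf hc j]
    ring
  · intro j _
    refine Integrable.const_mul ?_ _
    have i1 := df_int n f hf hc (fun p => (∑ k : Fin n, a k * p.1 k) * Real.exp (-Phi n a p)
      * p.2 j) (by fun_prop) ((Pi.single j 1 : Fin n → ℝ), (0 : Fin n → ℝ))
    have i2 := df_int n f hf hc (fun p => (∑ k : Fin n, a k * p.1 k) * Real.exp (-Phi n a p)
      * p.1 j) (by fun_prop) ((0 : Fin n → ℝ), (Pi.single j 1 : Fin n → ℝ))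
    refine (i1.sub i2).congr (Filter.Eventually.of_forall fun p => ?_)
    simp only [Pi.sub_apply]
    ring

lemma dop_cont (n : ℕ) (f : XX n → ℝ) (hf : ContDiff ℝ (⊤ : ℕ∞) f)
    (hc : HasCompactSupport f) : Continuous (Dop n f) := by
  have h := df_cont n f hf hc
  unfold Dop
  refine continuous_finsetSum _ fun j _ => ?_
  have h1 := h ((Pi.single j 1 : Fin n → ℝ), (0 : Fin n → ℝ))
  have h2 := h ((0 : Fin n → ℝ), (Pi.single j 1 : Fin n → ℝ))
  fun_prop

lemma dop_supp (n : ℕ) (f : XX n → ℝ) (hf : ContDiff ℝ (⊤ : ℕ∞) f)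
    (hc : HasCompactSupport f) : HasCompactSupport (Dop n f) := by
  refine (hc.fderiv ℝ).mono ?_
  intro p hp
  rw [Function.mem_support] at hp ⊢
  contrapose! hp
  simp [Dop, hp]



/-- H_{-1}-bound: for every smooth compactly supported `f`,
`|∫ g f dπ| ≤ ‖h‖_{L²(π)} · √2 · ‖f‖₁` where `‖f‖₁² = (1/2) ∫ (Df)² dπ`,
`g(c,s) = ∑ k a_k s_k` and `h(c,s) = ∑ a_k c_k`; moreover
`‖h‖_{L²(π)} = √(∑ a_j/j²)`. -/
theorem stmt_5 (n : ℕ) (a : Fin n → ℝ) (ha : ∀ k, 0 < a k) (C : ℝ)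
    (hprob : IsProbabilityMeasure (gaussPi n a C)) :
    (∀ f : (Fin n → ℝ) × (Fin n → ℝ) → ℝ, ContDiff ℝ (⊤ : ℕ∞) f → HasCompactSupport f →
      |∫ p, (∑ k : Fin n, ((k : ℝ) + 1) * a k * p.2 k) * f p ∂(gaussPi n a C)|
        ≤ Real.sqrt (∫ p, (∑ k : Fin n, a k * p.1 k) ^ 2 ∂(gaussPi n a C))
            * Real.sqrt 2
            * Real.sqrt ((1 / 2) * ∫ p, (Dop n f p) ^ 2 ∂(gaussPi n a C)))
    ∧ Real.sqrt (∫ p, (∑ k : Fin n, a k * p.1 k) ^ 2 ∂(gaussPi n a C))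
        = Real.sqrt (∑ j : Fin n, a j / ((j : ℝ) + 1) ^ 2) := by
  refine ⟨fun f hf hc => ?_, ?_⟩
  · have e : ∫ p, (∑ k : Fin n, ((k : ℝ) + 1) * a k * p.2 k) * f p ∂(gaussPi n a C)
        = - ∫ p, (∑ k : Fin n, a k * p.1 k) * Dop n f p ∂(gaussPi n a C) := by
      rw [gauss_integral, gauss_integral, part_all n a f hf hc, mul_neg]
    rw [e, abs_neg, mul_assoc, ← Real.sqrt_mul (by norm_num), ← mul_assoc]
    norm_num only [one_mul]
    refine cs _ _ _ ?_ ?_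
    · rw [memLp_two_iff_integrable_sq (by apply Continuous.aestronglyMeasurable; fun_prop)]
      exact gauss_h_integrable n a ha C hprob
    · exact (dop_cont n f hf hc).memLp_of_hasCompactSupport (dop_supp n f hf hc)
  · rw [gauss_integral, hsq_integral n a ha, mul_left_comm, gauss_one n a C hprob, mul_one]
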